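/- Along every solution (u, v, a, b) of system (ham), the Hamiltonian is conserved: the function t ↦ H(u(t), v(t), a(t), b(t)) = v(t)²/2 + (u(t)²/2)·(a(t)² + b(t)² − 1/4) − a(t)·b(t) is constant on ℝ. -/

import Mathlib

/-- The Hamiltonian of system (ham). -/
noncomputable def hamH (u v a b : ℝ) : ℝ :=
  v ^ 2 / 2 + u ^ 2 / 2 * (a ^ 2 + b ^ 2 - 1 / 4) - a * b

/-- Along every solution `(u, v, a, b)` of system (ham), the Hamiltonian
`H(u,v,a,b) = v²/2 + (u²/2)(a² + b² − 1/4) − ab` is constant on `ℝ`. -/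
theorem hamiltonian_conserved (u v a b : ℝ → ℝ)
    (hu : ∀ t, HasDerivAt u (v t) t)
    (hv : ∀ t, HasDerivAt v (-((a t) ^ 2 + (b t) ^ 2 - 1 / 4) * u t) t)
    (ha : ∀ t, HasDerivAt a (-(a t) + (u t) ^ 2 * b t) t)
    (hb : ∀ t, HasDerivAt b (b t - (u t) ^ 2 * a t) t) :
    ∀ s t : ℝ, hamH (u s) (v s) (a s) (b s) = hamH (u t) (v t) (a t) (b t) := by
  have hH : ∀ t, HasDerivAt (fun t => hamH (u t) (v t) (a t) (b t)) 0 t := by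
    intro t
    have h := ((((hv t).fun_pow 2).div_const 2).fun_add
      ((((hu t).fun_pow 2).div_const 2).fun_mul
        ((((ha t).fun_pow 2).fun_add ((hb t).fun_pow 2)).sub_const (1 / 4)))).fun_sub
      ((ha t).fun_mul (hb t))
    refine h.congr_deriv ?_
    push_cast
    ring
  exact is_const_of_deriv_eq_zero (fun t => (hH t).differentiableAt) fun t => (hH t).deriv
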